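/- Let n ≥ 1 and let A = Circulant(a_0,…,a_{n−1}) ∈ ℝ≥0^{n×n}. Then: (1) λ(A) = max_{k ∈ {0,…,n−1}} a_k; (2) there exists x ∈ ℝ≥0^n, x ≠ 0, with A⊗x = λ(A)·x, and for every μ ∈ ℝ≥0 and every x ≠ 0 with A⊗x = μ·x one has μ = λ(A) (so λ(A) is the unique max-algebraic eigenvalue of A); (3) if A ≠ 0 then λ(A) ≠ 0 and every node i ∈ {1,…,n} lies on a critical cycle of A. -/

import Mathlib

open scoped NNReal Classical

namespace MaxAlg

variable {n : ℕ}

/-- cyclic successor on `Fin k` -/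
def cyc {k : ℕ} (l : Fin k) : Fin k := ⟨(l.val + 1) % k, Nat.mod_lt _ l.pos⟩

/-- max-algebraic matrix product -/
noncomputable def mmul (A B : Matrix (Fin n) (Fin n) ℝ≥0) : Matrix (Fin n) (Fin n) ℝ≥0 :=
  fun i k => Finset.univ.sup fun j => A i j * B j k

/-- max-algebraic identity matrix -/
def mId (n : ℕ) : Matrix (Fin n) (Fin n) ℝ≥0 := fun i j => if i = j then 1 else 0

/-- max-algebraic matrix power -/
noncomputable def mpow (A : Matrix (Fin n) (Fin n) ℝ≥0) : ℕ → Matrix (Fin n) (Fin n) ℝ≥0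
  | 0 => mId n
  | t + 1 => mmul (mpow A t) A

/-- max-algebraic matrix-vector product -/
noncomputable def mvec (A : Matrix (Fin n) (Fin n) ℝ≥0) (x : Fin n → ℝ≥0) : Fin n → ℝ≥0 :=
  fun i => Finset.univ.sup fun j => A i j * x j

/-- geometric mean of the cycle `c` of length `k` -/
noncomputable def cycMean (A : Matrix (Fin n) (Fin n) ℝ≥0) (k : ℕ) (c : Fin k → Fin n) : ℝ≥0 :=
  (∏ l : Fin k, A (c l) (c (cyc l))) ^ ((1 : ℝ) / (k : ℝ))

/-- maximum cycle geometric mean λ(A) -/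
noncomputable def lam (A : Matrix (Fin n) (Fin n) ℝ≥0) : ℝ≥0 :=
  (Finset.Icc 1 n).sup fun k => Finset.univ.sup fun c : Fin k → Fin n => cycMean A k c

/-- attraction cone Attr(A) -/
def Attr (A : Matrix (Fin n) (Fin n) ℝ≥0) : Set (Fin n → ℝ≥0) :=
  {x | ∃ s : ℕ, mvec (mpow A (s + 1)) x = fun i => lam A * mvec (mpow A s) x i}

/-- circulant matrix built from the vector of values `a_0, …, a_{n-1}` -/
def circ (a : Fin n → ℝ≥0) : Matrix (Fin n) (Fin n) ℝ≥0 := fun i j => a (j - i)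

/-- A is a circulant matrix -/
def IsCirculant (A : Matrix (Fin n) (Fin n) ℝ≥0) : Prop := ∃ a : Fin n → ℝ≥0, A = circ a

/-- (i,j) is a critical edge of A -/
def IsCritEdge (A : Matrix (Fin n) (Fin n) ℝ≥0) (i j : Fin n) : Prop :=
  A i j ≠ 0 ∧ ∃ (k : ℕ) (c : Fin k → Fin n), 1 ≤ k ∧
    (∀ l, A (c l) (c (cyc l)) ≠ 0) ∧
    cycMean A k c = lam A ∧ ∃ l, c l = i ∧ c (cyc l) = j

/-- there is a walk of length ≥ 1 from i to j in crit(A) -/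
def CritWalk (A : Matrix (Fin n) (Fin n) ℝ≥0) (i j : Fin n) : Prop :=
  ∃ l : ℕ, 1 ≤ l ∧ ∃ w : ℕ → Fin n, w 0 = i ∧ w l = j ∧
    ∀ r < l, IsCritEdge A (w r) (w (r + 1))

/-- node i lies on a critical cycle of A -/
def OnCritCycle (A : Matrix (Fin n) (Fin n) ℝ≥0) (i : Fin n) : Prop :=
  ∃ (k : ℕ) (c : Fin k → Fin n), 1 ≤ k ∧
    (∀ l, A (c l) (c (cyc l)) ≠ 0) ∧
    cycMean A k c = lam A ∧ ∃ l, c l = i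

/-- family of one-dimensional intervals with bounds `lo`, `hi`,
each of one of the four forms -/
def IsIntervalFam (S : Fin n → Set ℝ≥0) (lo hi : Fin n → ℝ≥0) : Prop :=
  ∀ i, (S i).Nonempty ∧
    (S i = Set.Icc (lo i) (hi i) ∨ S i = Set.Ico (lo i) (hi i) ∨
     S i = Set.Ioc (lo i) (hi i) ∨ S i = Set.Ioo (lo i) (hi i))

/-- the interval 𝐗 ⊆ ℝ≥0ⁿ determined by the family S -/
def box (S : Fin n → Set ℝ≥0) : Set (Fin n → ℝ≥0) := {x | ∀ i, x i ∈ S i}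

/-- vertex x^{(k)}: x̄ in coordinate k and x̲ elsewhere -/
def vtx (lo hi : Fin n → ℝ≥0) (k : Fin n) : Fin n → ℝ≥0 :=
  Function.update lo k (hi k)

/-- the interval circulant matrix C(𝐚) determined by the interval family Sa -/
def Cset (Sa : Fin n → Set ℝ≥0) : Set (Matrix (Fin n) (Fin n) ℝ≥0) :=
  {A | ∃ a : Fin n → ℝ≥0, (∀ k, a k ∈ Sa k) ∧ A = circ a}

/-- the matrix Â, with â_k = min(a̲, ā_k) where a̲ = max_k a̲_k -/
noncomputable def Ahat (alo ahi : Fin n → ℝ≥0) : Matrix (Fin n) (Fin n) ℝ≥0 :=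
  circ fun k => min (Finset.univ.sup alo) (ahi k)

/-- the matrix A^{(k)} = Circulant(a̲_0,…,a̲_{k−1}, ā_k, a̲_{k+1},…,a̲_{n−1}) -/
def Ak (alo ahi : Fin n → ℝ≥0) (k : Fin n) : Matrix (Fin n) (Fin n) ℝ≥0 :=
  circ (Function.update alo k (ahi k))

end MaxAlg

namespace MaxAlg

lemma cyc_eq_add_one {m : ℕ} (l : Fin (m + 1)) : cyc l = l + 1 := by
  ext
  simp [cyc, Fin.val_add]

lemma cycMean_le {n k : ℕ} {A : Matrix (Fin n) (Fin n) ℝ≥0} {M : ℝ≥0} (hA : ∀ i j, A i j ≤ M)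
    (hk : k ≠ 0) (c : Fin k → Fin n) : cycMean A k c ≤ M := by
  have hprod : ∏ l : Fin k, A (c l) (c (cyc l)) ≤ M ^ k := by
    simpa using Finset.prod_le_prod' (s := Finset.univ)
      fun l _ => hA (c l) (c (cyc l))
  calc cycMean A k c ≤ (M ^ k) ^ ((1 : ℝ) / (k : ℝ)) := NNReal.rpow_le_rpow hprod (by positivity)
    _ = M := by rw [one_div, NNReal.pow_rpow_inv_natCast M hk]

lemma cycMean_eq_of_const {n k : ℕ} {A : Matrix (Fin n) (Fin n) ℝ≥0} {M : ℝ≥0} (hk : k ≠ 0)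
    {c : Fin k → Fin n} (hc : ∀ l, A (c l) (c (cyc l)) = M) : cycMean A k c = M := by
  simp only [cycMean, hc, Finset.prod_const, Finset.card_univ, Fintype.card_fin, one_div]
  exact NNReal.pow_rpow_inv_natCast M hk

open Fin.CommRing in
/-- Stepping by `d` from `i` gives a closed walk of length `n` using only entries `a d`. -/
lemma exists_const_cycle {n : ℕ} (hn : 1 ≤ n) (a : Fin n → ℝ≥0) (i d : Fin n) :
    ∃ c : Fin n → Fin n, (∀ l, circ a (c l) (c (cyc l)) = a d) ∧ ∃ l, c l = i := by
  obtain ⟨m, rfl⟩ := Nat.exists_eq_add_of_le' hn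
  refine ⟨fun l => i + l * d, fun l => ?_, 0, by ring⟩
  have h : i + (l + 1) * d - (i + l * d) = d := by ring
  simp only [circ, cyc_eq_add_one]
  exact congrArg a h

lemma circ_sub_right {n : ℕ} (a : Fin n → ℝ≥0) (j d : Fin n) : circ a (j - d) j = a d := by
  have : NeZero n := ⟨d.pos.ne'⟩
  exact congrArg a (sub_sub_cancel j d)

lemma circ_le_sup {n : ℕ} (a : Fin n → ℝ≥0) (i j : Fin n) : circ a i j ≤ Finset.univ.sup a :=
  Finset.le_sup (f := a) (Finset.mem_univ _)

lemma exists_eq_sup {n : ℕ} (hn : 1 ≤ n) (a : Fin n → ℝ≥0) : ∃ d, Finset.univ.sup a = a d := by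
  have : Nonempty (Fin n) := ⟨⟨0, hn⟩⟩
  obtain ⟨d, -, hd⟩ := Finset.exists_mem_eq_sup Finset.univ Finset.univ_nonempty a
  exact ⟨d, hd⟩

lemma lam_circ {n : ℕ} (hn : 1 ≤ n) (a : Fin n → ℝ≥0) : lam (circ a) = Finset.univ.sup a := by
  apply le_antisymm
  · exact Finset.sup_le fun k hk => Finset.sup_le fun c _ =>
      cycMean_le (circ_le_sup a) (by have := Finset.mem_Icc.mp hk; omega) c
  · obtain ⟨d, hd⟩ := exists_eq_sup hn a
    obtain ⟨c, hc, -⟩ := exists_const_cycle hn a ⟨0, hn⟩ d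
    rw [hd, ← cycMean_eq_of_const (by omega) hc]
    exact (Finset.le_sup (f := cycMean (circ a) n) (Finset.mem_univ c)).trans
      (Finset.le_sup (f := fun k => Finset.univ.sup (cycMean (circ a) k))
        (Finset.mem_Icc.mpr ⟨hn, le_rfl⟩))

lemma le_mvec {n : ℕ} (A : Matrix (Fin n) (Fin n) ℝ≥0) (x : Fin n → ℝ≥0) (i j : Fin n) :
    A i j * x j ≤ mvec A x i :=
  Finset.le_sup (f := fun j => A i j * x j) (Finset.mem_univ j)

lemma mvec_circ_one {n : ℕ} (hn : 1 ≤ n) (a : Fin n → ℝ≥0) (i : Fin n) :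
    mvec (circ a) (fun _ => 1) i = Finset.univ.sup a := by
  apply le_antisymm
  · exact Finset.sup_le fun j _ => by simpa using circ_le_sup a i j
  · have : NeZero n := ⟨by omega⟩
    obtain ⟨d, hd⟩ := exists_eq_sup hn a
    have h := le_mvec (circ a) (fun _ => 1) i (i + d)
    have hc : circ a i (i + d) = a d := congrArg a (add_sub_cancel_left i d)
    rwa [hc, mul_one, ← hd] at h

lemma eigenvalue_circ_eq {n : ℕ} (hn : 1 ≤ n) (a : Fin n → ℝ≥0) {μ : ℝ≥0} {x : Fin n → ℝ≥0}
    (hx : x ≠ 0) (h : mvec (circ a) x = fun i => μ * x i) : μ = Finset.univ.sup a := by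
  obtain ⟨j, hj⟩ := exists_eq_sup hn x
  have hle : ∀ i, x i ≤ x j := fun i => hj ▸ Finset.le_sup (Finset.mem_univ i)
  have hpos : 0 < x j := by
    obtain ⟨i, hi⟩ := Function.ne_iff.mp hx
    exact (pos_iff_ne_zero.mpr hi).trans_le (hle i)
  apply le_antisymm
  · refine le_of_mul_le_mul_right ?_ hpos
    rw [← congrFun h j]
    exact Finset.sup_le fun l _ => mul_le_mul' (circ_le_sup a j l) (hle l)
  · obtain ⟨d, hd⟩ := exists_eq_sup hn a
    refine le_of_mul_le_mul_right ?_ hpos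
    have hb := le_mvec (circ a) x (j - d) j
    rw [circ_sub_right, ← hd, h] at hb
    exact hb.trans (mul_le_mul_right (hle _) μ)

end MaxAlg

open MaxAlg in
/-- spectral theory of circulant matrices: (1) `λ(A) = max_k a_k`;
(2) `λ(A)` is the unique max-algebraic eigenvalue of `A`;
(3) if `A ≠ 0` then `λ(A) ≠ 0` and every node lies on a critical cycle. -/
theorem circulant_spectral
    (n : ℕ) (hn : 1 ≤ n) (a : Fin n → ℝ≥0) :
    lam (circ a) = Finset.univ.sup a ∧
    ((∃ x : Fin n → ℝ≥0, x ≠ 0 ∧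
        mvec (circ a) x = fun i => lam (circ a) * x i) ∧
      ∀ (μ : ℝ≥0) (x : Fin n → ℝ≥0), x ≠ 0 →
        mvec (circ a) x = (fun i => μ * x i) → μ = lam (circ a)) ∧
    (circ a ≠ 0 → lam (circ a) ≠ 0 ∧ ∀ i : Fin n, OnCritCycle (circ a) i) := by
  have hlam := lam_circ hn a
  refine ⟨hlam, ⟨⟨fun _ => 1, ?_, ?_⟩, fun μ x hx h => ?_⟩, fun hA => ?_⟩
  · exact Function.ne_iff.mpr ⟨⟨0, hn⟩, one_ne_zero⟩
  · funext i
    rw [mvec_circ_one hn, hlam, mul_one]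
  · rw [hlam, eigenvalue_circ_eq hn a hx h]
  · have h0 : lam (circ a) ≠ 0 := fun h => hA <| by
      ext i j
      simpa [← hlam, h] using circ_le_sup a i j
    refine ⟨h0, fun i => ?_⟩
    obtain ⟨d, hd⟩ := exists_eq_sup hn a
    obtain ⟨c, hc, hi⟩ := exists_const_cycle hn a i d
    have hcl : ∀ l, circ a (c l) (c (cyc l)) = lam (circ a) := fun l => by rw [hc, hlam, hd]
    exact ⟨n, c, hn, fun l => by rwa [hcl], cycMean_eq_of_const (by omega) hcl, hi⟩
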